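/- Let R = [a,b] × [c,d] be a compact rectangle in ℝ² with a < b and c < d. Suppose g : ℝ² → ℝ is smooth (infinitely differentiable), g vanishes at every point of the topological boundary ∂R of R, and the integral of g over R (with respect to Lebesgue measure) is zero. Then there exist smooth functions P, Q : ℝ² → ℝ, both vanishing at every point of ∂R, such that for every point z = (x,y) ∈ R one has (∂Q/∂x)(z) − (∂P/∂y)(z) = g(z). (This is the 'Poincaré lemma with zero boundary values' step used in the reduction of Theorem 3 to Theorem 1: a 2-form on the rectangle that vanishes on the boundary and has total integral zero is the exterior derivative of a 1-form vanishing on the boundary.) -/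

import Mathlib

open MeasureTheory

section ParametricIntegral

variable {H E : Type*} [NormedAddCommGroup H] [NormedSpace ℝ H] [FiniteDimensional ℝ H]
  [NormedAddCommGroup E] [NormedSpace ℝ E]

/-- Differentiation under the integral sign for a `C^1` integrand. -/
theorem hasFDerivAt_intervalIntegral_of_contDiff {F : H × ℝ → E} (hF : ContDiff ℝ 1 F)
    (a b : ℝ) (x₀ : H) :
    HasFDerivAt (fun x => ∫ t in a..b, F (x, t))
      (∫ t in a..b, (fderiv ℝ F (x₀, t)).comp (ContinuousLinearMap.inl ℝ H ℝ)) x₀ := by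
  have : ProperSpace H := FiniteDimensional.proper ℝ H
  have hF' : Continuous fun p : H × ℝ =>
      (fderiv ℝ F p).comp (ContinuousLinearMap.inl ℝ H ℝ) :=
    (hF.continuous_fderiv one_ne_zero).clm_comp continuous_const
  have hFc := hF.continuous
  obtain ⟨U, hU, hUx⟩ := exists_compact_mem_nhds x₀
  obtain ⟨M, hM⟩ := ((hU.prod (isCompact_uIcc (a := a) (b := b))).bddAbove_image
    hF'.norm.continuousOn)
  refine intervalIntegral.hasFDerivAt_integral_of_dominated_of_fderiv_le
    (F' := fun x t => (fderiv ℝ F (x, t)).comp (ContinuousLinearMap.inl ℝ H ℝ))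
    (bound := fun _ => M) hUx ?_ ?_ ?_ ?_ intervalIntegrable_const ?_
  · exact .of_forall fun x =>
      (show Continuous fun t => F (x, t) by fun_prop).aestronglyMeasurable
  · exact (show Continuous fun t => F (x₀, t) by fun_prop).intervalIntegrable _ _
  · exact (hF'.comp (Continuous.prodMk_right x₀)).aestronglyMeasurable
  · exact .of_forall fun t ht x hx =>
      hM ⟨(x, t), ⟨hx, Set.uIoc_subset_uIcc ht⟩, rfl⟩
  · refine .of_forall fun t _ x _ => ?_
    exact ((hF.differentiable one_ne_zero (x, t)).hasFDerivAt).comp x (hasFDerivAt_prodMk_left x t)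

theorem ContDiff.parametric_intervalIntegral_nat {n : ℕ} {F : H × ℝ → E} (hF : ContDiff ℝ n F)
    (a b : ℝ) : ContDiff ℝ n fun x => ∫ t in a..b, F (x, t) := by
  induction n generalizing F with
  | zero =>
    have hFc := hF.continuous
    have : ProperSpace H := FiniteDimensional.proper ℝ H
    exact contDiff_zero.2 <| intervalIntegral.continuous_parametric_intervalIntegral_of_continuous'
      (f := fun x t => F (x, t)) hFc a b
  | succ n ih =>
    have h1 : ContDiff ℝ 1 F := hF.of_le (by simp)
    have hd := hasFDerivAt_intervalIntegral_of_contDiff h1 a b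
    rw [Nat.cast_succ] at hF ⊢
    refine contDiff_succ_iff_fderiv_apply.2 ⟨fun x => (hd x).differentiableAt, by simp, ?_⟩
    intro y
    have hF' : Continuous fun p : H × ℝ =>
        (fderiv ℝ F p).comp (ContinuousLinearMap.inl ℝ H ℝ) :=
      (h1.continuous_fderiv one_ne_zero).clm_comp continuous_const
    have key : (fun x => fderiv ℝ (fun x => ∫ t in a..b, F (x, t)) x y) =
        fun x => ∫ t in a..b, fderiv ℝ F (x, t) (y, 0) := by
      funext x
      have h_integrable : IntervalIntegrable
          (fun t => (fderiv ℝ F (x, t)).comp (ContinuousLinearMap.inl ℝ H ℝ)) volume a b :=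
        (hF'.comp (Continuous.prodMk_right x)).intervalIntegrable _ _
      rw [(hd x).fderiv, ContinuousLinearMap.intervalIntegral_apply h_integrable]
      simp
    rw [key]
    exact ih (F := fun p => fderiv ℝ F p (y, 0))
      ((hF.fderiv_right le_rfl).clm_apply contDiff_const)

/-- Integrating out one variable of a smooth function gives a smooth function. -/
theorem ContDiff.parametric_intervalIntegral {F : H × ℝ → E} (hF : ContDiff ℝ (⊤ : ℕ∞) F)
    (a b : ℝ) : ContDiff ℝ (⊤ : ℕ∞) fun x => ∫ t in a..b, F (x, t) :=
  contDiff_infty.2 fun n => (contDiff_infty.1 hF n).parametric_intervalIntegral_nat a b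

/-- The primitive, in one variable, of a smooth function is jointly smooth. -/
theorem ContDiff.parametric_primitive {F : H × ℝ → E} (hF : ContDiff ℝ (⊤ : ℕ∞) F) (a : ℝ) :
    ContDiff ℝ (⊤ : ℕ∞) fun p : H × ℝ => ∫ t in a..p.2, F (p.1, t) := by
  have key : (fun p : H × ℝ => ∫ t in a..p.2, F (p.1, t)) =
      fun p => (p.2 - a) • ∫ s in (0 : ℝ)..1, F (p.1, a + (p.2 - a) * s) := by
    funext p
    rw [intervalIntegral.smul_integral_comp_add_mul (fun t => F (p.1, t))]
    simp
  rw [key]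
  refine (contDiff_snd.sub contDiff_const).smul ?_
  refine ContDiff.parametric_intervalIntegral
    (F := fun q : (H × ℝ) × ℝ => F (q.1.1, a + (q.1.2 - a) * q.2)) ?_ 0 1
  exact hF.comp (by fun_prop)

end ParametricIntegral

theorem frontier_Icc_prod_Icc {a b c d : ℝ} (hab : a ≤ b) (hcd : c ≤ d) :
    frontier (Set.Icc a b ×ˢ Set.Icc c d) =
      Set.Icc a b ×ˢ {c, d} ∪ {a, b} ×ˢ Set.Icc c d := by
  rw [frontier_prod_eq, frontier_Icc hab, frontier_Icc hcd, isClosed_Icc.closure_eq,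
    isClosed_Icc.closure_eq]

/-- A cubic polynomial is a primitive of a quadratic one vanishing at `c` and `d`. -/
theorem hasDerivAt_smoothstep (c d y : ℝ) :
    HasDerivAt (fun y => (y - c) ^ 2 * (3 * d - c - 2 * y) / (d - c) ^ 3)
      (6 * (y - c) * (d - y) / (d - c) ^ 3) y := by
  have h1 : HasDerivAt (fun y : ℝ => y - c) 1 y := (hasDerivAt_id y).sub_const c
  have h2 : HasDerivAt (fun y : ℝ => 3 * d - c - 2 * y) (-(2 * 1)) y :=
    ((hasDerivAt_id y).const_mul 2).const_sub _
  refine (((h1.pow 2).mul h2).div_const ((d - c) ^ 3)).congr_deriv ?_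
  simp only [Pi.pow_apply]
  push_cast
  ring

/-- Poincaré lemma with zero boundary values on a rectangle: a smooth function `g`
(the coefficient of a 2-form) which vanishes on the topological boundary of the
compact rectangle `R = [a,b] × [c,d]` and has total integral zero over `R` is the
"curl" `∂Q/∂x − ∂P/∂y` of a pair of smooth functions `P, Q` (the components of a
1-form `β = P dx + Q dy`) vanishing on the boundary of `R`. -/
theorem poincare_lemma_zero_boundary
    (a b c d : ℝ) (hab : a < b) (hcd : c < d)
    (g : ℝ × ℝ → ℝ) (hg : ContDiff ℝ (⊤ : ℕ∞) g)
    (hg_bdry : ∀ z ∈ frontier (Set.Icc a b ×ˢ Set.Icc c d), g z = 0)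
    (hg_int : ∫ z in Set.Icc a b ×ˢ Set.Icc c d, g z = 0) :
    ∃ P Q : ℝ × ℝ → ℝ,
      ContDiff ℝ (⊤ : ℕ∞) P ∧ ContDiff ℝ (⊤ : ℕ∞) Q ∧
      (∀ z ∈ frontier (Set.Icc a b ×ˢ Set.Icc c d), P z = 0) ∧
      (∀ z ∈ frontier (Set.Icc a b ×ˢ Set.Icc c d), Q z = 0) ∧
      (∀ z ∈ Set.Icc a b ×ˢ Set.Icc c d,
        fderiv ℝ Q z (1, 0) - fderiv ℝ P z (0, 1) = g z) := by
  rw [frontier_Icc_prod_Icc hab.le hcd.le] at *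
  set h : ℝ → ℝ := fun x => ∫ t in c..d, g (x, t) with h_def
  have hh : ContDiff ℝ (⊤ : ℕ∞) h := hg.parametric_intervalIntegral c d
  have hH : ContDiff ℝ (⊤ : ℕ∞) fun x => ∫ s in a..x, h s := by
    have := ContDiff.parametric_primitive (H := ℝ) (F := fun p => h p.2)
      (hh.comp contDiff_snd) a
    exact this.comp (contDiff_const (c := (0 : ℝ)) |>.prodMk contDiff_id)
  have hG : ContDiff ℝ (⊤ : ℕ∞) fun p : ℝ × ℝ => ∫ t in c..p.2, g (p.1, t) :=
    hg.parametric_primitive c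
  have hHb : ∫ s in a..b, h s = 0 := by
    rw [← hg_int, Measure.volume_eq_prod, setIntegral_prod _
      (hg.continuous.continuousOn.integrableOn_compact (isCompact_Icc.prod isCompact_Icc)),
      intervalIntegral.integral_of_le hab.le, ← integral_Icc_eq_integral_Ioc]
    simp only [h_def, intervalIntegral.integral_of_le hcd.le, ← integral_Icc_eq_integral_Ioc]
  have hG_side : ∀ x ∈ ({a, b} : Set ℝ), ∀ y ∈ Set.Icc c d, ∫ t in c..y, g (x, t) = 0 := by
    intro x hx y hy
    refine intervalIntegral.integral_zero_ae (.of_forall fun t ht => ?_)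
    rw [Set.uIoc_of_le hy.1] at ht
    exact hg_bdry (x, t) (Or.inr ⟨hx, ht.1.le, ht.2.trans hy.2⟩)
  have hh_side : ∀ x ∈ ({a, b} : Set ℝ), h x = 0 := fun x hx =>
    hG_side x hx d (Set.right_mem_Icc.2 hcd.le)
  have hdc : d - c ≠ 0 := sub_ne_zero.2 hcd.ne'
  set Φ : ℝ → ℝ := fun y => (y - c) ^ 2 * (3 * d - c - 2 * y) / (d - c) ^ 3 with Φ_def
  set φ : ℝ → ℝ := fun y => 6 * (y - c) * (d - y) / (d - c) ^ 3 with φ_def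
  have hΦ : ContDiff ℝ (⊤ : ℕ∞) Φ := by fun_prop
  have hφ : ContDiff ℝ (⊤ : ℕ∞) φ := by fun_prop
  have hΦd : Φ d = 1 := by
    simp only [Φ_def]; field_simp; ring
  have hP : ContDiff ℝ (⊤ : ℕ∞)
      fun p : ℝ × ℝ => h p.1 * Φ p.2 - ∫ t in c..p.2, g (p.1, t) :=
    ((hh.comp contDiff_fst).mul (hΦ.comp contDiff_snd)).sub hG
  have hQ : ContDiff ℝ (⊤ : ℕ∞) fun p : ℝ × ℝ => (∫ s in a..p.1, h s) * φ p.2 :=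
    (hH.comp contDiff_fst).mul (hφ.comp contDiff_snd)
  refine ⟨_, _, hP, hQ, ?_, ?_, ?_⟩
  · rintro ⟨x, y⟩ (⟨-, rfl | rfl⟩ | ⟨hx, hy⟩)
    · simp [Φ_def]
    · simp [hΦd, h_def]
    · simp [hh_side x hx, hG_side x hx y hy]
  · rintro ⟨x, y⟩ (⟨-, rfl | rfl⟩ | ⟨rfl | rfl, -⟩)
    · simp [φ_def]
    · simp [φ_def]
    · simp
    · simp [hHb]
  · rintro ⟨x, y⟩ -
    have hQx := ((hQ.differentiable (by simp) (x, y)).hasFDerivAt).comp_hasDerivAt x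
      ((hasDerivAt_id x).prodMk (hasDerivAt_const x y))
    have hPy := ((hP.differentiable (by simp) (x, y)).hasFDerivAt).comp_hasDerivAt y
      ((hasDerivAt_const y x).prodMk (hasDerivAt_id y))
    have hgx : Continuous fun t => g (x, t) := hg.continuous.comp (Continuous.prodMk_right x)
    have hQx' : HasDerivAt (fun x => (∫ s in a..x, h s) * φ y) (h x * φ y) x :=
      (hh.continuous.integral_hasStrictDerivAt a x).hasDerivAt.mul_const _
    have hPy' : HasDerivAt (fun y => h x * Φ y - ∫ t in c..y, g (x, t))
        (h x * φ y - g (x, y)) y :=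
      ((hasDerivAt_smoothstep c d y).const_mul _).sub
        (hgx.integral_hasStrictDerivAt c y).hasDerivAt
    rw [hQx.unique hQx', hPy.unique hPy']
    ring
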